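/- arXiv:2105.13462 — 3 statements merged into one kernel-verified Lean document; each statement's English description precedes it below -/
import Mathlib

section
/- Let f(x, W) = f̃(W₁x, W₂) be twice continuously differentiable in W = (W₁, W₂), let x₁, …, xₙ ∈ ℝ^d be nonzero training inputs with labels y₁, …, yₙ, let L̂(W) = (1/(2n)) Σᵢ (f(xᵢ, W) − yᵢ)², and let W* = (W₁*, W₂*) be an interpolation solution (f(xᵢ, W*) = yᵢ for all i). Then (1/n) Σᵢ₌₁ⁿ ‖∇_x f(xᵢ, W*)‖₂² ≤ (‖W₁*‖₂² / minᵢ ‖xᵢ‖₂²) · tr(∇²_W L̂(W*)); that is, the mean squared gradient of the model function at the training data is bounded by the flatness of the minimum times ‖W₁*‖₂²/minᵢ‖xᵢ‖₂². -/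
/-- Matrix–vector product of `W : ℝ^{m×d}` (as a function) with `x : ℝ^d`. -/
noncomputable def mVec {m d : ℕ} (W : Fin m → Fin d → ℝ) (x : Fin d → ℝ) : Fin m → ℝ :=
  fun r => ∑ s, W r s * x s

/-- Euclidean (ℓ²) norm of a vector in `ℝ^d`. -/
noncomputable def l2norm {d : ℕ} (v : Fin d → ℝ) : ℝ := Real.sqrt (∑ j, v j ^ 2)

/-- Operator norm of a matrix induced by Euclidean norms. -/
noncomputable def opNorm2 {m d : ℕ} (W : Fin m → Fin d → ℝ) : ℝ :=
  sSup {r : ℝ | ∃ x : Fin d → ℝ, l2norm x = 1 ∧ r = l2norm (mVec W x)}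

/-- Empirical square loss for the model `f(x, W) = f̃(W₁x, W₂)` with parameters
`W = (W₁, W₂)`. -/
noncomputable def empLossP {m d p n : ℕ} (ft : (Fin m → ℝ) → (Fin p → ℝ) → ℝ)
    (x : Fin n → Fin d → ℝ) (y : Fin n → ℝ) :
    ((Fin m → Fin d → ℝ) × (Fin p → ℝ)) → ℝ :=
  fun W => (1 / (2 * (n : ℝ))) * ∑ i, (ft (mVec W.1 (x i)) W.2 - y i) ^ 2

lemma l2norm_nonneg {d : ℕ} (v : Fin d → ℝ) : 0 ≤ l2norm v := Real.sqrt_nonneg _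

lemma l2norm_sq {d : ℕ} (v : Fin d → ℝ) : l2norm v ^ 2 = ∑ j, v j ^ 2 :=
  Real.sq_sqrt (Finset.sum_nonneg fun _ _ => sq_nonneg _)

lemma l2norm_pos {d : ℕ} {v : Fin d → ℝ} (hv : v ≠ 0) : 0 < l2norm v := by
  obtain ⟨j, hj⟩ := Function.ne_iff.1 hv
  exact Real.sqrt_pos.2 (Finset.sum_pos' (fun _ _ => sq_nonneg _)
    ⟨j, Finset.mem_univ _, pow_pos (abs_pos.2 hj) 2 |>.trans_eq (sq_abs _)⟩)

lemma l2norm_smul {d : ℕ} (c : ℝ) (v : Fin d → ℝ) : l2norm (c • v) = |c| * l2norm v := by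
  simp only [l2norm, Pi.smul_apply, smul_eq_mul, mul_pow, ← Finset.mul_sum]
  rw [Real.sqrt_mul (sq_nonneg c), Real.sqrt_sq_eq_abs]

lemma mVec_smul_right {m d : ℕ} (W : Fin m → Fin d → ℝ) (c : ℝ) (x : Fin d → ℝ) :
    mVec W (c • x) = c • mVec W x := by
  ext r
  simp only [mVec, Pi.smul_apply, smul_eq_mul, Finset.mul_sum]
  exact Finset.sum_congr rfl fun s _ => by ring

lemma l2norm_mVec_sq_le {m d : ℕ} (W : Fin m → Fin d → ℝ) (x : Fin d → ℝ) :
    l2norm (mVec W x) ^ 2 ≤ (∑ r, ∑ s, W r s ^ 2) * l2norm x ^ 2 := by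
  rw [l2norm_sq, l2norm_sq, Finset.sum_mul]
  exact Finset.sum_le_sum fun r _ => Finset.sum_mul_sq_le_sq_mul_sq _ _ _

lemma bddAbove_l2norm_mVec {m d : ℕ} (W : Fin m → Fin d → ℝ) :
    BddAbove {r : ℝ | ∃ x : Fin d → ℝ, l2norm x = 1 ∧ r = l2norm (mVec W x)} := by
  refine ⟨Real.sqrt (∑ r, ∑ s, W r s ^ 2), ?_⟩
  rintro _ ⟨x, hx, rfl⟩
  exact Real.le_sqrt_of_sq_le (by simpa [hx] using l2norm_mVec_sq_le W x)

lemma l2norm_mVec_le {m d : ℕ} (W : Fin m → Fin d → ℝ) {x : Fin d → ℝ} (hx : x ≠ 0) :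
    l2norm (mVec W x) ≤ opNorm2 W * l2norm x := by
  have hpos := l2norm_pos hx
  have h : l2norm (mVec W ((l2norm x)⁻¹ • x)) ≤ opNorm2 W := by
    refine le_csSup (bddAbove_l2norm_mVec W) ⟨_, ?_, rfl⟩
    rw [l2norm_smul, abs_of_pos (inv_pos.2 hpos), inv_mul_cancel₀ hpos.ne']
  rwa [mVec_smul_right, l2norm_smul, abs_of_pos (inv_pos.2 hpos), inv_mul_le_iff₀ hpos,
    mul_comm] at h

/-- The transpose of `W` is bounded by the operator norm of `W`. -/
lemma sum_sq_transpose_mul_le {m d : ℕ} (W : Fin m → Fin d → ℝ) (a : Fin m → ℝ) :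
    ∑ j, (∑ r, a r * W r j) ^ 2 ≤ opNorm2 W ^ 2 * ∑ r, a r ^ 2 := by
  set u : Fin d → ℝ := fun j => ∑ r, a r * W r j with hu_def
  change ∑ j, u j ^ 2 ≤ _
  rcases eq_or_ne u 0 with hu | hu
  · simp only [hu, Pi.zero_apply, ne_eq, OfNat.ofNat_ne_zero, not_false_eq_true, zero_pow,
      Finset.sum_const_zero]
    positivity
  have hpos : 0 < l2norm u ^ 2 := pow_pos (l2norm_pos hu) 2
  have hdual : l2norm u ^ 2 = ∑ r, a r * mVec W u r := by
    simp only [l2norm_sq, mVec, Finset.mul_sum]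
    rw [Finset.sum_comm]
    refine Finset.sum_congr rfl fun j _ => ?_
    rw [sq]
    nth_rewrite 1 [hu_def]
    simp only [Finset.sum_mul, mul_assoc]
  have hcs : (l2norm u ^ 2) ^ 2 ≤ (∑ r, a r ^ 2) * l2norm (mVec W u) ^ 2 := by
    rw [hdual, l2norm_sq]
    exact Finset.sum_mul_sq_le_sq_mul_sq _ _ _
  have hop : l2norm (mVec W u) ^ 2 ≤ opNorm2 W ^ 2 * l2norm u ^ 2 := by
    rw [← mul_pow]
    exact pow_le_pow_left₀ (l2norm_nonneg _) (l2norm_mVec_le W hu) 2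
  rw [← l2norm_sq]
  have ha : 0 ≤ ∑ r, a r ^ 2 := Finset.sum_nonneg fun _ _ => sq_nonneg _
  refine le_of_mul_le_mul_right ?_ hpos
  calc l2norm u ^ 2 * l2norm u ^ 2 = (l2norm u ^ 2) ^ 2 := (sq _).symm
    _ ≤ (∑ r, a r ^ 2) * l2norm (mVec W u) ^ 2 := hcs
    _ ≤ (∑ r, a r ^ 2) * (opNorm2 W ^ 2 * l2norm u ^ 2) := mul_le_mul_of_nonneg_left hop ha
    _ = opNorm2 W ^ 2 * (∑ r, a r ^ 2) * l2norm u ^ 2 := by ring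

/-- At an interpolation point the Hessian of the square loss is the Gauss–Newton form. -/
lemma fderiv_fderiv_sq_loss_of_interp {E : Type*} [NormedAddCommGroup E] [NormedSpace ℝ E]
    {n : ℕ} (G : Fin n → E → ℝ) (hG : ∀ i, ContDiff ℝ 2 (G i)) (y : Fin n → ℝ) {w : E}
    (hw : ∀ i, G i w = y i) (v : E) :
    fderiv ℝ (fun W => fderiv ℝ
      (fun W => (1 / (2 * (n : ℝ))) * ∑ i, (G i W - y i) ^ 2) W v) w v
      = (1 / (n : ℝ)) * ∑ i, (fderiv ℝ (G i) w v) ^ 2 := by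
  have hd : ∀ i, Differentiable ℝ (G i) := fun i => (hG i).differentiable (by norm_num)
  have hd' : ∀ i, Differentiable ℝ (fun W => fderiv ℝ (G i) W v) := fun i =>
    (((hG i).fderiv_right (m := 1) (by norm_num)).differentiable (by norm_num)).clm_apply
      (differentiable_const v)
  have hfirst : (fun W => fderiv ℝ
      (fun W => (1 / (2 * (n : ℝ))) * ∑ i, (G i W - y i) ^ 2) W v)
      = fun W => (1 / (n : ℝ)) * ∑ i, (G i W - y i) * fderiv ℝ (G i) W v := by
    funext W
    have h := (HasFDerivAt.fun_sum (u := Finset.univ) fun i _ =>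
      (((hd i W).hasFDerivAt.sub_const (y i)).pow 2)).const_mul (1 / (2 * (n : ℝ)))
    rw [h.fderiv]
    simp only [smul_apply, sum_apply, smul_eq_mul,
      Finset.mul_sum]
    refine Finset.sum_congr rfl fun i _ => ?_
    simp
    ring
  rw [hfirst]
  have h := (HasFDerivAt.fun_sum (u := Finset.univ) fun i _ =>
    (((hd i w).hasFDerivAt.sub_const (y i)).fun_mul (hd' i w).hasFDerivAt)).const_mul (1 / (n : ℝ))
  rw [h.fderiv]
  simp [hw, sq]

/-- The parameter-to-preactivation map `(W₁, W₂) ↦ (W₁ x, W₂)`. -/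
noncomputable def preactivation {m d : ℕ} (p : ℕ) (x : Fin d → ℝ) :
    ((Fin m → Fin d → ℝ) × (Fin p → ℝ)) →L[ℝ] (Fin m → ℝ) × (Fin p → ℝ) :=
  LinearMap.toContinuousLinearMap
    { toFun := fun W => (mVec W.1 x, W.2)
      map_add' := fun W W' => by
        ext r <;> simp [mVec, add_mul, Finset.sum_add_distrib]
      map_smul' := fun c W => by
        ext r <;> simp [mVec, mul_assoc, Finset.mul_sum] }

lemma preactivation_apply {m d p : ℕ} (x : Fin d → ℝ)
    (W : (Fin m → Fin d → ℝ) × (Fin p → ℝ)) : preactivation p x W = (mVec W.1 x, W.2) := rfl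

lemma mVec_single {m d : ℕ} (x : Fin d → ℝ) (r : Fin m) (s : Fin d) :
    mVec (Pi.single r (Pi.single s 1)) x = x s • Pi.single r (1 : ℝ) := by
  ext r'
  rcases eq_or_ne r' r with rfl | h
  · simp [mVec, Pi.single_apply]
  · simp [mVec, h]

lemma fderiv_model_weight {m d p : ℕ} {F : (Fin m → ℝ) × (Fin p → ℝ) → ℝ}
    (hF : Differentiable ℝ F) (x : Fin d → ℝ) (W : (Fin m → Fin d → ℝ) × (Fin p → ℝ))
    (r : Fin m) (s : Fin d) :
    fderiv ℝ (fun W : (Fin m → Fin d → ℝ) × (Fin p → ℝ) => F (mVec W.1 x, W.2)) W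
        (Pi.single r (Pi.single s 1), 0)
      = fderiv ℝ F (mVec W.1 x, W.2) (Pi.single r 1, 0) * x s := by
  have h := (hF (mVec W.1 x, W.2)).hasFDerivAt.comp W (preactivation p x).hasFDerivAt
  have h' : fderiv ℝ (fun W : (Fin m → Fin d → ℝ) × (Fin p → ℝ) => F (mVec W.1 x, W.2)) W = _ :=
    h.fderiv
  have hv : (x s • Pi.single r (1 : ℝ), (0 : Fin p → ℝ))
      = x s • ((Pi.single r (1 : ℝ) : Fin m → ℝ), (0 : Fin p → ℝ)) := by simp
  rw [h', ContinuousLinearMap.comp_apply, preactivation_apply, mVec_single, hv, map_smul,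
    smul_eq_mul, mul_comm]

lemma fderiv_model_input {m d p : ℕ} {F : (Fin m → ℝ) × (Fin p → ℝ) → ℝ}
    (hF : Differentiable ℝ F) (x : Fin d → ℝ) (W : (Fin m → Fin d → ℝ) × (Fin p → ℝ))
    (j : Fin d) :
    fderiv ℝ (fun z => F (mVec W.1 z, W.2)) x (Pi.single j 1)
      = ∑ r, fderiv ℝ F (mVec W.1 x, W.2) (Pi.single r 1, 0) * W.1 r j := by
  let A : (Fin d → ℝ) →L[ℝ] (Fin m → ℝ) := (Matrix.mulVecLin (Matrix.of W.1)).toContinuousLinearMap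
  have hA : HasFDerivAt (fun z => (mVec W.1 z, W.2)) (A.prod 0) x :=
    A.hasFDerivAt.prodMk (hasFDerivAt_const W.2 x)
  have h := (hF (mVec W.1 x, W.2)).hasFDerivAt.comp x hA
  have h' : fderiv ℝ (fun z => F (mVec W.1 z, W.2)) x = _ := h.fderiv
  have hv : (A.prod (0 : (Fin d → ℝ) →L[ℝ] (Fin p → ℝ))) (Pi.single j 1)
      = ∑ r, W.1 r j • ((Pi.single r (1 : ℝ) : Fin m → ℝ), (0 : Fin p → ℝ)) := by
    ext r
    · simp [A, Prod.fst_sum, Finset.sum_apply, Pi.single_apply]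
    · simp [Prod.snd_sum]
  rw [h', ContinuousLinearMap.comp_apply, hv, map_sum]
  exact Finset.sum_congr rfl fun r _ => by rw [map_smul, smul_eq_mul, mul_comm]

/-- at an interpolation solution `W* = (W₁*, W₂*)`, the mean squared input
gradient of the model at the training data is bounded by
`(‖W₁*‖₂² / minᵢ ‖xᵢ‖₂²) · tr(∇²_W L̂(W*))`. -/
theorem mean_input_grad_sq_le_flatness
    {m d p n : ℕ} (hn : 0 < n)
    (ft : (Fin m → ℝ) → (Fin p → ℝ) → ℝ)
    (hft : ContDiff ℝ 2 (fun q : (Fin m → ℝ) × (Fin p → ℝ) => ft q.1 q.2))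
    (x : Fin n → Fin d → ℝ) (hx : ∀ i, x i ≠ 0) (y : Fin n → ℝ)
    (Wstar : (Fin m → Fin d → ℝ) × (Fin p → ℝ))
    (hinterp : ∀ i, ft (mVec Wstar.1 (x i)) Wstar.2 = y i) :
    (1 / (n : ℝ)) *
        ∑ i, ∑ j, (fderiv ℝ (fun z => ft (mVec Wstar.1 z) Wstar.2) (x i) (Pi.single j 1)) ^ 2
      ≤ ((opNorm2 Wstar.1) ^ 2 /
            (Finset.univ.inf' ⟨⟨0, hn⟩, Finset.mem_univ _⟩ fun i => l2norm (x i)) ^ 2) *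
        ((∑ r, ∑ s, fderiv ℝ
              (fun W => fderiv ℝ (empLossP ft x y) W (Pi.single r (Pi.single s 1), 0))
              Wstar (Pi.single r (Pi.single s 1), 0))
          + ∑ l, fderiv ℝ
              (fun W => fderiv ℝ (empLossP ft x y) W (0, Pi.single l 1))
              Wstar (0, Pi.single l 1)) := by
  let F : (Fin m → ℝ) × (Fin p → ℝ) → ℝ := fun q => ft q.1 q.2
  have hF : Differentiable ℝ F := hft.differentiable (by norm_num)
  let G : Fin n → (Fin m → Fin d → ℝ) × (Fin p → ℝ) → ℝ := fun i W => F (mVec W.1 (x i), W.2)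
  have hG : ∀ i, ContDiff ℝ 2 (G i) := fun i => hft.comp (preactivation p (x i)).contDiff
  have hess : ∀ v, fderiv ℝ (fun W => fderiv ℝ (empLossP ft x y) W v) Wstar v
      = (1 / (n : ℝ)) * ∑ i, (fderiv ℝ (G i) Wstar v) ^ 2 :=
    fun v => fderiv_fderiv_sq_loss_of_interp G hG y hinterp v
  set a : Fin n → Fin m → ℝ := fun i r =>
    fderiv ℝ F (mVec Wstar.1 (x i), Wstar.2) (Pi.single r 1, 0)
  have hinput : ∀ i j, fderiv ℝ (fun z => ft (mVec Wstar.1 z) Wstar.2) (x i) (Pi.single j 1)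
      = ∑ r, a i r * Wstar.1 r j := fun i j => fderiv_model_input hF (x i) Wstar j
  have hweight : ∀ i r s, fderiv ℝ (G i) Wstar (Pi.single r (Pi.single s 1), 0)
      = a i r * x i s := fun i r s => fderiv_model_weight hF (x i) Wstar r s
  simp only [hess, hinput, hweight]
  set μ := Finset.univ.inf' ⟨⟨0, hn⟩, Finset.mem_univ _⟩ fun i => l2norm (x i)
  have hμ : 0 < μ := (Finset.lt_inf'_iff _).2 fun i _ => l2norm_pos (hx i)
  have hle : ∀ i, μ ≤ l2norm (x i) := fun i => Finset.inf'_le _ (Finset.mem_univ i)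
  have hn' : 0 ≤ 1 / (n : ℝ) := by positivity
  have htrace : ∑ r, ∑ s, (1 / (n : ℝ)) * ∑ i, (a i r * x i s) ^ 2
      = (1 / (n : ℝ)) * ∑ i, (∑ r, a i r ^ 2) * l2norm (x i) ^ 2 := by
    simp only [← Finset.mul_sum, l2norm_sq, Finset.sum_mul, mul_pow]
    congr 1
    simp only [Finset.sum_comm (s := (Finset.univ : Finset (Fin d)))]
    rw [Finset.sum_comm]
    simp only [Finset.mul_sum]
  have hlower : μ ^ 2 * ∑ i, ∑ r, a i r ^ 2 ≤ ∑ i, (∑ r, a i r ^ 2) * l2norm (x i) ^ 2 := by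
    rw [Finset.mul_sum]
    refine Finset.sum_le_sum fun i _ => ?_
    rw [mul_comm]
    exact mul_le_mul_of_nonneg_left (pow_le_pow_left₀ hμ.le (hle i) 2)
      (Finset.sum_nonneg fun _ _ => sq_nonneg _)
  have hrest : 0 ≤ ∑ l, (1 / (n : ℝ)) * ∑ i, (fderiv ℝ (G i) Wstar (0, Pi.single l 1)) ^ 2 :=
    Finset.sum_nonneg fun _ _ => mul_nonneg hn' (Finset.sum_nonneg fun _ _ => sq_nonneg _)
  rw [htrace]
  calc (1 / (n : ℝ)) * ∑ i, ∑ j, (∑ r, a i r * Wstar.1 r j) ^ 2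
      ≤ (1 / (n : ℝ)) * ∑ i, opNorm2 Wstar.1 ^ 2 * ∑ r, a i r ^ 2 :=
        mul_le_mul_of_nonneg_left
          (Finset.sum_le_sum fun i _ => sum_sq_transpose_mul_le Wstar.1 (a i)) hn'
    _ = (opNorm2 Wstar.1 ^ 2 / μ ^ 2) * ((1 / (n : ℝ)) * (μ ^ 2 * ∑ i, ∑ r, a i r ^ 2)) := by
        rw [← Finset.mul_sum]
        field_simp
    _ ≤ _ := mul_le_mul_of_nonneg_left
        ((mul_le_mul_of_nonneg_left hlower hn').trans (le_add_of_nonneg_right hrest))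
        (by positivity)
end

section
/- Let c₁, …, cₙ be nonnegative real numbers, η > 0, and let k ≥ 1 and 1 ≤ B ≤ n be integers. If |(1/C(n,B)) Σ_𝔍 (1 − (η/B) Σ_{i∈𝔍} cᵢ)^k| ≤ 1, where the sum ranges over all B-element subsets 𝔍 of {1, …, n}, then (1/n) Σᵢ₌₁ⁿ cᵢ^k ≤ 2^k B^{k−1} / η^k. In particular, taking cᵢ = a_{i,j}² where aᵢ = ∇_W f(xᵢ, W*) and j is any parameter coordinate, k-th order linear stability of SGD with learning rate η and batch size B at a global minimum W* implies (1/n) Σᵢ₌₁ⁿ a_{i,j}^{2k} ≤ 2^k B^{k−1} / η^k. -/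
open Finset

/-- Summing `f` over every `B`-element subset counts each index `C(n-1, B-1)` times. -/
lemma card_mul_sum_powersetCard_sum {ι : Type*} [Fintype ι] {B : ℕ} (hB : 1 ≤ B)
    (hn : 1 ≤ Fintype.card ι) (f : ι → ℝ) :
    (Fintype.card ι : ℝ) * ∑ J ∈ powersetCard B (univ : Finset ι), ∑ i ∈ J, f i =
      ((Fintype.card ι).choose B : ℝ) * B * ∑ i, f i := by
  classical
  have hcount (i : ι) :
      #{J ∈ powersetCard B (univ : Finset ι) | i ∈ J} = (Fintype.card ι - 1).choose (B - 1) := by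
    simpa using card_filter_powersetCard_subset {i} (univ : Finset ι) B (subset_univ _) (by simpa)
  have hswap : ∑ J ∈ powersetCard B (univ : Finset ι), ∑ i ∈ J, f i =
      ((Fintype.card ι - 1).choose (B - 1) : ℝ) * ∑ i, f i := by
    rw [sum_comm' (t' := univ) (s' := fun i => {J ∈ powersetCard B (univ : Finset ι) | i ∈ J})
      (by simp), mul_sum]
    simp_rw [sum_const, hcount, nsmul_eq_mul]
  have hchoose : Fintype.card ι * (Fintype.card ι - 1).choose (B - 1) =
      (Fintype.card ι).choose B * B := by
    simpa [Nat.sub_add_cancel hB, Nat.sub_add_cancel hn] using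
      Nat.add_one_mul_choose_eq (Fintype.card ι - 1) (B - 1)
  rw [hswap, ← mul_assoc]
  congr 1
  exact_mod_cast hchoose

lemma sum_pow_le_pow_sum_of_nonneg {ι : Type*} (s : Finset ι) {f : ι → ℝ}
    (hf : ∀ i, 0 ≤ f i) {k : ℕ} (hk : k ≠ 0) : ∑ i ∈ s, f i ^ k ≤ (∑ i ∈ s, f i) ^ k := by
  classical
  induction s using Finset.induction_on with
  | empty => simp [hk]
  | insert a s ha ih =>
    rw [sum_insert ha, sum_insert ha]
    grw [ih]
    exact pow_add_pow_le (hf a) (sum_nonneg fun i _ => hf i) hk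

/-- The tangent bound at `y = 2` for `y ^ k` in terms of `(y - 1) ^ k`. -/
lemma pow_le_two_pow_mul_sub_one_pow_add_one {y : ℝ} (hy : 0 ≤ y) {k : ℕ} (hk : k ≠ 0) :
    y ^ k ≤ 2 ^ (k - 1) * ((y - 1) ^ k + 1) := by
  rcases le_total 1 y with h | h
  · simpa using add_pow_le (sub_nonneg.2 h) zero_le_one k
  have htwo : (1 : ℝ) ≤ 2 ^ (k - 1) := one_le_pow₀ one_le_two
  suffices hle : y ^ k ≤ (y - 1) ^ k + 1 from
    hle.trans (le_mul_of_one_le_left ((pow_nonneg hy k).trans hle) htwo)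
  rcases k.even_or_odd with he | ho
  · linarith [he.pow_nonneg (y - 1), pow_le_one₀ (n := k) hy h]
  · have hadd := pow_add_pow_le hy (sub_nonneg.2 h) hk
    rw [add_sub_cancel, one_pow] at hadd
    rw [← neg_sub 1 y, ho.neg_pow]
    linarith

/-- if the batch-averaged stability quantity
`|(1/C(n,B)) Σ_𝔍 (1 − (η/B) Σ_{i∈𝔍} cᵢ)^k|` is at most `1` for nonnegative `c₁,…,cₙ`, then
`(1/n) Σᵢ cᵢ^k ≤ 2^k B^{k−1} / η^k`. -/
theorem moment_bound_from_linear_stability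
    {n : ℕ} (B k : ℕ) (hk : 1 ≤ k) (hB : 1 ≤ B) (hBn : B ≤ n)
    (η : ℝ) (hη : 0 < η)
    (c : Fin n → ℝ) (hc : ∀ i, 0 ≤ c i)
    (hstab : |((n.choose B : ℝ))⁻¹ *
        ∑ J ∈ Finset.powersetCard B (Finset.univ : Finset (Fin n)),
          (1 - (η / (B : ℝ)) * ∑ i ∈ J, c i) ^ k| ≤ 1) :
    (1 / (n : ℝ)) * ∑ i, (c i) ^ k ≤ 2 ^ k * (B : ℝ) ^ (k - 1) / η ^ k := by
  have hnpos : 1 ≤ n := hB.trans hBn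
  have hk0 : k ≠ 0 := by lia
  have hBpos : (0 : ℝ) < B := by exact_mod_cast hB
  have hN : (0 : ℝ) < n.choose B := by exact_mod_cast Nat.choose_pos hBn
  have hn : (0 : ℝ) < n := by exact_mod_cast hnpos
  set P := powersetCard B (univ : Finset (Fin n)) with hP
  set y : Finset (Fin n) → ℝ := fun J => (η / B) * ∑ i ∈ J, c i with hy
  have hy0 (J) : 0 ≤ y J := mul_nonneg (by positivity) (sum_nonneg fun i _ => hc i)
  have hcentered : ∑ J ∈ P, (y J - 1) ^ k ≤ n.choose B := by
    have hflip : ∑ J ∈ P, (y J - 1) ^ k = (-1) ^ k * ∑ J ∈ P, (1 - y J) ^ k := by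
      rw [mul_sum]
      exact sum_congr rfl fun J _ => by rw [← mul_pow]; ring
    rw [abs_mul, abs_of_pos (inv_pos.2 hN), inv_mul_le_iff₀ hN, mul_one] at hstab
    rw [hflip]
    refine (le_abs_self _).trans ?_
    rwa [abs_mul, abs_pow, abs_neg, abs_one, one_pow, one_mul]
  have hmoment : ∑ J ∈ P, y J ^ k ≤ 2 ^ k * n.choose B := by
    calc ∑ J ∈ P, y J ^ k ≤ ∑ J ∈ P, 2 ^ (k - 1) * ((y J - 1) ^ k + 1) :=
          sum_le_sum fun J _ => pow_le_two_pow_mul_sub_one_pow_add_one (hy0 J) hk0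
      _ = 2 ^ (k - 1) * (∑ J ∈ P, (y J - 1) ^ k + n.choose B) := by
          rw [← mul_sum, sum_add_distrib]
          simp [hP]
      _ ≤ 2 ^ (k - 1) * (n.choose B + n.choose B) := by gcongr
      _ = 2 ^ k * n.choose B := by rw [← pow_sub_one_mul hk0 (2 : ℝ)]; ring
  have hlower : (η / B) ^ k * ∑ J ∈ P, ∑ i ∈ J, c i ^ k ≤ 2 ^ k * n.choose B := by
    refine le_trans ?_ hmoment
    rw [mul_sum]
    refine sum_le_sum fun J _ => ?_
    rw [hy, mul_pow]
    gcongr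
    exact sum_pow_le_pow_sum_of_nonneg J hc hk0
  have hcount := card_mul_sum_powersetCard_sum hB (by rwa [Fintype.card_fin]) fun i : Fin n => c i ^ k
  rw [Fintype.card_fin] at hcount
  rw [div_pow, div_mul_eq_mul_div, div_le_iff₀ (by positivity)] at hlower
  rw [one_div, inv_mul_le_iff₀ hn, ← mul_div_assoc, le_div_iff₀ (by positivity)]
  refine le_of_mul_le_mul_left ?_ (mul_pos hN hBpos)
  calc (n.choose B : ℝ) * B * ((∑ i, c i ^ k) * η ^ k)
      = n * (η ^ k * ∑ J ∈ P, ∑ i ∈ J, c i ^ k) := by rw [← mul_assoc, ← hcount]; ring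
    _ ≤ n * (2 ^ k * n.choose B * B ^ k) := by gcongr
    _ = n.choose B * B * (n * (2 ^ k * B ^ (k - 1))) := by
        rw [← pow_sub_one_mul hk0 (B : ℝ)]; ring
end

section
/- Let f̃ : ℝ^m × ℝ^p → ℝ be differentiable, W₁ ∈ ℝ^{m×d}, W₂ ∈ ℝ^p, k ≥ 1 an integer, and x ∈ ℝ^d with x ≠ 0. Then ‖∇_x f̃(W₁x, W₂)‖_{2k}^{2k} ≤ (‖W₁ᵀ‖_{2k}^{2k} / ‖x‖_{2k}^{2k}) · ‖∇_{W₁} f̃(W₁x, W₂)‖_{2k}^{2k}, where ∇_{W₁} f̃(W₁x, W₂) is the gradient of V ↦ f̃(Vx, W₂) at V = W₁ (the matrix (∂f̃/∂(W₁x)) xᵀ, flattened entrywise); consequently the same bound holds with ‖∇_W f̃(W₁x, W₂)‖_{2k}^{2k} on the right, where ∇_W denotes the gradient with respect to all parameters (W₁, W₂). -/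
/-- ℓ^{2k} norm of a vector. -/
noncomputable def lpnorm (k : ℕ) {d : ℕ} (v : Fin d → ℝ) : ℝ :=
  (∑ j, |v j| ^ (2 * k)) ^ ((2 * k : ℝ))⁻¹

/-- Operator norm of a matrix induced by ℓ^{2k} norms on domain and codomain. -/
noncomputable def opNormP (k : ℕ) {m d : ℕ} (W : Fin m → Fin d → ℝ) : ℝ :=
  sSup {r : ℝ | ∃ x : Fin d → ℝ, lpnorm k x = 1 ∧ r = lpnorm k (mVec W x)}

section

variable {m d : ℕ}

/-- Matrix–vector product as a continuous linear map of the vector. -/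
noncomputable def mVecCLM (W : Fin m → Fin d → ℝ) : (Fin d → ℝ) →L[ℝ] (Fin m → ℝ) :=
  LinearMap.toContinuousLinearMap
    { toFun := mVec W
      map_add' := fun y z => by ext r; simp [mVec, mul_add, Finset.sum_add_distrib]
      map_smul' := fun c y => by ext r; simp [mVec, Finset.mul_sum, mul_left_comm] }

theorem mVecCLM_apply (W : Fin m → Fin d → ℝ) (y : Fin d → ℝ) :
    mVecCLM W y = mVec W y := rfl

/-- Matrix–vector product as a continuous linear map of the matrix. -/
noncomputable def mVecFlipCLM (x : Fin d → ℝ) : (Fin m → Fin d → ℝ) →L[ℝ] (Fin m → ℝ) :=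
  LinearMap.toContinuousLinearMap
    { toFun := fun V => mVec V x
      map_add' := fun V W => by ext r; simp [mVec, add_mul, Finset.sum_add_distrib]
      map_smul' := fun c V => by ext r; simp [mVec, Finset.mul_sum, mul_assoc] }

theorem mVec_single_right (W : Fin m → Fin d → ℝ) (j : Fin d) :
    mVec W (Pi.single j 1) = fun r => W r j := by
  ext r; simp [mVec, Pi.single_apply]

theorem mVec_single_left (x : Fin d → ℝ) (r : Fin m) (s : Fin d) :
    mVec (Pi.single r (Pi.single s 1)) x = x s • Pi.single r (1 : ℝ) := by
  ext i
  by_cases h : i = r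
  · subst h; simp [mVec, Pi.single_apply]
  · simp [mVec, h]

theorem lpnorm_nonneg (k : ℕ) (v : Fin d → ℝ) : 0 ≤ lpnorm k v := by
  unfold lpnorm; positivity

theorem lpnorm_pow {k : ℕ} (hk : 1 ≤ k) (v : Fin d → ℝ) :
    lpnorm k v ^ (2 * k) = ∑ j, |v j| ^ (2 * k) := by
  have h := Real.rpow_inv_natCast_pow (x := ∑ j, |v j| ^ (2 * k)) (n := 2 * k)
    (by positivity) (by lia)
  simpa [lpnorm] using h

theorem lpnorm_smul {k : ℕ} (hk : 1 ≤ k) (c : ℝ) (v : Fin d → ℝ) :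
    lpnorm k (c • v) = |c| * lpnorm k v := by
  refine (pow_left_inj₀ (lpnorm_nonneg _ _)
    (mul_nonneg (abs_nonneg _) (lpnorm_nonneg _ _)) (by lia : 2 * k ≠ 0)).1 ?_
  rw [mul_pow, lpnorm_pow hk, lpnorm_pow hk, Finset.mul_sum]
  simp [abs_mul, mul_pow]

theorem continuous_lpnorm {k : ℕ} : Continuous (lpnorm k : (Fin d → ℝ) → ℝ) := by
  unfold lpnorm
  exact Continuous.rpow_const (by fun_prop) fun _ => Or.inr (by positivity)

theorem abs_apply_le_lpnorm {k : ℕ} (hk : 1 ≤ k) (v : Fin d → ℝ) (j : Fin d) :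
    |v j| ≤ lpnorm k v := by
  refine (pow_le_pow_iff_left₀ (abs_nonneg _) (lpnorm_nonneg _ _) (by lia : 2 * k ≠ 0)).1 ?_
  rw [lpnorm_pow hk]
  exact Finset.single_le_sum (f := fun j => |v j| ^ (2 * k))
    (fun _ _ => by positivity) (Finset.mem_univ j)

theorem bddAbove_lpnorm_mVec {k : ℕ} (hk : 1 ≤ k) (W : Fin m → Fin d → ℝ) :
    BddAbove {r : ℝ | ∃ x : Fin d → ℝ, lpnorm k x = 1 ∧ r = lpnorm k (mVec W x)} := by
  have hcont : Continuous fun x => lpnorm k (mVecCLM W x) :=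
    continuous_lpnorm.comp (mVecCLM W).continuous
  refine ((isCompact_closedBall (0 : Fin d → ℝ) 1).bddAbove_image hcont.continuousOn).mono ?_
  rintro _ ⟨x, hx, rfl⟩
  refine ⟨x, ?_, rfl⟩
  rw [mem_closedBall_zero_iff, pi_norm_le_iff_of_nonneg zero_le_one]
  exact fun j => hx ▸ abs_apply_le_lpnorm hk x j

theorem lpnorm_mVec_le {k : ℕ} (hk : 1 ≤ k) (W : Fin m → Fin d → ℝ) (v : Fin d → ℝ) :
    lpnorm k (mVec W v) ≤ opNormP k W * lpnorm k v := by
  rcases (lpnorm_nonneg k v).eq_or_lt with h | h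
  · have hv : v = 0 := by
      ext j
      exact abs_nonpos_iff.1 (h ▸ abs_apply_le_lpnorm hk v j)
    have hW : mVec W v = (0 : ℝ) • (0 : Fin m → ℝ) := by ext; simp [hv, mVec]
    rw [← h, hW, lpnorm_smul hk]
    simp
  · have hunit : lpnorm k ((lpnorm k v)⁻¹ • v) = 1 := by
      rw [lpnorm_smul hk, abs_of_pos (inv_pos.2 h), inv_mul_cancel₀ h.ne']
    have hle := le_csSup (bddAbove_lpnorm_mVec hk W) ⟨_, hunit, rfl⟩
    rw [← mVecCLM_apply, map_smul, lpnorm_smul hk, abs_of_pos (inv_pos.2 h),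
      mVecCLM_apply, inv_mul_le_iff₀ h, mul_comm] at hle
    exact hle

theorem sum_abs_mVec_pow_le {k : ℕ} (hk : 1 ≤ k) (W : Fin m → Fin d → ℝ) (v : Fin d → ℝ) :
    ∑ j, |mVec W v j| ^ (2 * k) ≤ opNormP k W ^ (2 * k) * ∑ j, |v j| ^ (2 * k) := by
  rw [← lpnorm_pow hk, ← lpnorm_pow hk, ← mul_pow]
  exact pow_le_pow_left₀ (lpnorm_nonneg _ _) (lpnorm_mVec_le hk W v) _

theorem sum_abs_pow_le_opNormP_pow_div_mul {k : ℕ} (hk : 1 ≤ k) (W : Fin m → Fin d → ℝ)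
    {x : Fin d → ℝ} (hx : x ≠ 0) (L : (Fin m → ℝ) →L[ℝ] ℝ) :
    ∑ j, |L (mVec W (Pi.single j 1))| ^ (2 * k)
      ≤ (opNormP k (fun s r => W r s) ^ (2 * k) / ∑ s, |x s| ^ (2 * k)) *
        ∑ r, ∑ s, |L (mVec (Pi.single r (Pi.single s 1)) x)| ^ (2 * k) := by
  have hx0 : (∑ s, |x s| ^ (2 * k)) ≠ 0 := by
    obtain ⟨s, hs⟩ := Function.ne_iff.1 hx
    have hs' : 0 < |x s| := abs_pos.2 hs
    exact (Finset.sum_pos' (fun _ _ => by positivity) ⟨s, Finset.mem_univ s, by positivity⟩).ne'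
  have hgrad : ∑ r, ∑ s, |L (mVec (Pi.single r (Pi.single s 1)) x)| ^ (2 * k)
      = (∑ s, |x s| ^ (2 * k)) * ∑ r, |L (Pi.single r 1)| ^ (2 * k) := by
    simp only [mVec_single_left, map_smul, smul_eq_mul, abs_mul, mul_pow]
    rw [Finset.sum_comm, Finset.sum_mul_sum]
  have hcol (j : Fin d) : L (mVec W (Pi.single j 1))
      = mVec (fun s r => W r s) (fun r => L (Pi.single r 1)) j := by
    rw [mVec_single_right, pi_eq_sum_univ' (fun r => W r j), map_sum]
    simp [mVec]
  rw [hgrad, ← mul_assoc, div_mul_cancel₀ _ hx0]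
  simp only [hcol]
  exact sum_abs_mVec_pow_le hk _ _

end

/-- `‖∇_x f̃(W₁x, W₂)‖_{2k}^{2k} ≤ (‖W₁ᵀ‖_{2k}^{2k}/‖x‖_{2k}^{2k}) ·
‖∇_{W₁} f̃(W₁x, W₂)‖_{2k}^{2k}`, and the same bound holds with the gradient with respect to
all parameters `(W₁, W₂)` on the right-hand side. -/
theorem grad_x_2k_le_opnorm_mul_grad_W
    {m d p : ℕ} (k : ℕ) (hk : 1 ≤ k)
    (ft : (Fin m → ℝ) → (Fin p → ℝ) → ℝ)
    (hft : Differentiable ℝ (fun q : (Fin m → ℝ) × (Fin p → ℝ) => ft q.1 q.2))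
    (W1 : Fin m → Fin d → ℝ) (W2 : Fin p → ℝ)
    (x : Fin d → ℝ) (hx : x ≠ 0) :
    (∑ j, |fderiv ℝ (fun z => ft (mVec W1 z) W2) x (Pi.single j 1)| ^ (2 * k)
      ≤ ((opNormP k (fun s r => W1 r s)) ^ (2 * k) / ∑ s, |x s| ^ (2 * k)) *
        ∑ r, ∑ s, |fderiv ℝ (fun V : Fin m → Fin d → ℝ => ft (mVec V x) W2) W1
            (Pi.single r (Pi.single s 1))| ^ (2 * k)) ∧
    (∑ j, |fderiv ℝ (fun z => ft (mVec W1 z) W2) x (Pi.single j 1)| ^ (2 * k)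
      ≤ ((opNormP k (fun s r => W1 r s)) ^ (2 * k) / ∑ s, |x s| ^ (2 * k)) *
        ((∑ r, ∑ s, |fderiv ℝ
              (fun V : (Fin m → Fin d → ℝ) × (Fin p → ℝ) => ft (mVec V.1 x) V.2) (W1, W2)
              (Pi.single r (Pi.single s 1), 0)| ^ (2 * k))
          + ∑ l, |fderiv ℝ
              (fun V : (Fin m → Fin d → ℝ) × (Fin p → ℝ) => ft (mVec V.1 x) V.2) (W1, W2)
              (0, Pi.single l 1)| ^ (2 * k))) := by

  set G := fderiv ℝ (fun q : (Fin m → ℝ) × (Fin p → ℝ) => ft q.1 q.2) (mVec W1 x, W2)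
  have hG : HasFDerivAt (fun q : (Fin m → ℝ) × (Fin p → ℝ) => ft q.1 q.2) G (mVec W1 x, W2) :=
    (hft _).hasFDerivAt
  have hinput := HasFDerivAt.comp x hG ((mVecCLM W1).hasFDerivAt.prodMk (hasFDerivAt_const W2 x))
  have hfirst := HasFDerivAt.comp W1 hG
    ((mVecFlipCLM x).hasFDerivAt.prodMk (hasFDerivAt_const W2 W1))
  have hall := HasFDerivAt.comp (W1, W2) hG
    ((mVecFlipCLM x).prodMap (ContinuousLinearMap.id ℝ (Fin p → ℝ))).hasFDerivAt
  have hx' (v) : fderiv ℝ (fun z => ft (mVec W1 z) W2) x v = G (mVec W1 v, 0) :=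
    congrArg (· v) hinput.fderiv
  have hW1 (V) : fderiv ℝ (fun V : Fin m → Fin d → ℝ => ft (mVec V x) W2) W1 V
      = G (mVec V x, 0) := congrArg (· V) hfirst.fderiv
  have hW (V) : fderiv ℝ (fun V : (Fin m → Fin d → ℝ) × (Fin p → ℝ) => ft (mVec V.1 x) V.2)
      (W1, W2) V = G (mVec V.1 x, V.2) := congrArg (· V) hall.fderiv
  have key := sum_abs_pow_le_opNormP_pow_div_mul hk W1 hx
    (G.comp (ContinuousLinearMap.inl ℝ (Fin m → ℝ) (Fin p → ℝ)))
  simp only [ContinuousLinearMap.comp_apply, ContinuousLinearMap.inl_apply] at key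
  simp only [hx', hW1, hW]
  have hcoef : 0 ≤ opNormP k (fun s r => W1 r s) ^ (2 * k) / ∑ s, |x s| ^ (2 * k) :=
    div_nonneg (Even.pow_nonneg (even_two_mul k) _) (by positivity)
  exact ⟨key, key.trans (mul_le_mul_of_nonneg_left
    (le_add_of_nonneg_right (by positivity)) hcoef)⟩
end
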